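/- Let n be a natural number and let Sq : (ZMod 2)[X] → (ZMod 2)[X] be the ring homomorphism determined by X ↦ X + X^2 (the total Steenrod square on the mod 2 cohomology of RP^∞). Then Sq applied to the polynomial Σ_{i=0}^{n} (Nat.choose (n-i) i) • X^i is congruent to (1+X)^(n+1) modulo the ideal generated by X^(n+1). Concretely: Σ_{i=0}^{n} C(n-i, i)·(X + X^2)^i ≡ (1+X)^(n+1) mod X^(n+1) over ZMod 2. (This expresses the Wu formula w = Sq(v) on RP^n, where the total Wu class of RP^n is v(RP^n) = Σ_i C(n-i,i)·a^i and the total Stiefel–Whitney class is (1+a)^(n+1).) -/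

import Mathlib

open Polynomial Finset

/-- The total Steenrod square on the mod 2 cohomology of `RP^∞`, i.e. the ring
homomorphism `(Z/2)[X] → (Z/2)[X]` determined by `X ↦ X + X^2`. -/
noncomputable def totalSq : Polynomial (ZMod 2) →+* Polynomial (ZMod 2) :=
  (aeval ((X : Polynomial (ZMod 2)) + X ^ 2)).toRingHom

theorem wu_rec {R : Type*} [CommRing R] (t : R) (n : ℕ) :
    ∑ p ∈ antidiagonal (n + 2), (Nat.choose p.2 p.1 : R) * t ^ p.1
    = ∑ p ∈ antidiagonal (n + 1), (Nat.choose p.2 p.1 : R) * t ^ p.1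
      + t * ∑ p ∈ antidiagonal n, (Nat.choose p.2 p.1 : R) * t ^ p.1 := by
  rw [Finset.Nat.sum_antidiagonal_succ, Finset.Nat.sum_antidiagonal_succ',
    Finset.Nat.sum_antidiagonal_succ (n := n), mul_sum]
  simp only [Nat.choose_succ_succ, Nat.choose_zero_right, Nat.choose_zero_succ, Nat.cast_add,
    add_mul, sum_add_distrib, pow_succ]
  have : ∀ p : ℕ × ℕ, (Nat.choose p.2 p.1 : R) * (t ^ p.1 * t)
      = t * ((Nat.choose p.2 p.1 : R) * t ^ p.1) := fun p => by ring
  simp only [this]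
  simp
  ring

theorem wu_closed (n : ℕ) :
    ∑ p ∈ antidiagonal n, (Nat.choose p.2 p.1 : Polynomial (ZMod 2)) * (X + X ^ 2) ^ p.1
    = (1 + X) ^ (n + 1) + X ^ (n + 1) := by
  have h2 : (2 : Polynomial (ZMod 2)) = 0 := CharTwo.two_eq_zero
  induction n using Nat.twoStepInduction with
  | zero =>
    simp
    linear_combination (-X) * h2
  | one =>
    simp [Finset.Nat.antidiagonal_succ]
    linear_combination (-X - X ^ 2) * h2
  | more n ih1 ih2 =>
    rw [wu_rec, ih1, ih2]
    linear_combination (X ^ (n + 2)) * h2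

/-- The Wu formula `w = Sq(v)` on `RP^n`: applying the total Steenrod square to
the total Wu class `Σ_{i=0}^{n} C(n-i, i) • X^i` gives the total
Stiefel–Whitney class `(1+X)^(n+1)`, modulo the ideal `(X^(n+1))`. -/
theorem wu_formula_rp (n : ℕ) :
    Ideal.Quotient.mk (Ideal.span {(X : Polynomial (ZMod 2)) ^ (n + 1)})
      (totalSq (∑ i ∈ range (n + 1), (Nat.choose (n - i) i) • (X : Polynomial (ZMod 2)) ^ i))
    = Ideal.Quotient.mk (Ideal.span {(X : Polynomial (ZMod 2)) ^ (n + 1)})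
      ((1 + X) ^ (n + 1)) := by
  have h : totalSq (∑ i ∈ range (n + 1), (Nat.choose (n - i) i) • (X : Polynomial (ZMod 2)) ^ i)
      = (1 + X) ^ (n + 1) + X ^ (n + 1) := by
    rw [← wu_closed, Finset.Nat.sum_antidiagonal_eq_sum_range_succ_mk]
    simp [totalSq, map_sum]
  rw [h, Ideal.Quotient.eq, add_sub_cancel_left]
  exact Ideal.subset_span rfl
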